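/- Let p be a probability distribution on a finite set, and for each n consider the product distribution p^{⊗n}. For b' ∈ ℝ, let m_n = n + ⌊b'√n⌋ and consider p^{⊗ m_n}. If V(p) > 0, then for a = H(p) and any b ∈ ℝ, lim_{n→∞} P_{p^{⊗ m_n}}( −log p^{⊗ m_n}(x) ≤ a n + b √n ) = G( (b − H(p) b') / √V(p) ). -/

import Mathlib

open MeasureTheory Real Set Filter

/-- The standard normal cumulative distribution function. -/
noncomputable def stdGaussianCDF (x : ℝ) : ℝ :=
  ∫ t in Set.Iic x, (1 / Real.sqrt (2 * Real.pi)) * Real.exp (-t ^ 2 / 2)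

open ProbabilityTheory Topology in
/-- CLT along a sequence of sample sizes, with a moving threshold. -/
lemma clt_shift {Ω : Type*} {mΩ : MeasurableSpace Ω} (P : Measure Ω) [IsProbabilityMeasure P]
    (X : ℕ → Ω → ℝ) (hX : ∀ i, Measurable (X i))
    (h0 : P[X 0] = 0) (h1 : P[X 0 ^ 2] = 1) (hindep : iIndepFun X P)
    (hident : ∀ (i : ℕ), IdentDistrib (X i) (X 0) P P)
    (m : ℕ → ℕ) (hm : Tendsto m atTop atTop) (t : ℕ → ℝ) (t₀ : ℝ)
    (ht : Tendsto t atTop (𝓝 t₀)) :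
    Tendsto (fun n => P.real {ω | (√(m n : ℝ))⁻¹ * ∑ k ∈ Finset.range (m n), X k ω ≤ t n}) atTop
      (𝓝 (stdGaussianCDF t₀)) := by
  have hY : HasLaw (id : ℝ → ℝ) (gaussianReal 0 1) (gaussianReal 0 1) := HasLaw.id
  have h := tendstoInDistribution_inv_sqrt_mul_sum hY h0 h1 hindep hident
  have h2 : TendstoInDistribution
      (fun (n : ℕ) ω ↦ (√(m n : ℝ))⁻¹ * ∑ k ∈ Finset.range (m n), X k ω) atTop id
      (fun _ ↦ P) (gaussianReal 0 1) :=
    ⟨fun n => h.forall_aemeasurable (m n), h.aemeasurable_limit, h.tendsto.comp hm⟩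
  have h3 := h2.add_of_tendstoInMeasure_const (Y := fun n _ => -t n) (c := -t₀)
    (by
      refine tendstoInMeasure_of_tendsto_ae (fun n => by fun_prop) ?_
      exact ae_of_all _ fun _ => ht.neg) (fun n => by fun_prop)
  have hpre : (fun ω : ℝ => id ω + -t₀) ⁻¹' Set.Iic 0 = Set.Iic t₀ := by
    ext x; simp
  have hpre' : (fun ω : ℝ => id ω + -t₀) ⁻¹' {0} = {t₀} := by
    ext x; simp [add_neg_eq_zero]
  have h4 := ProbabilityMeasure.tendsto_measure_of_null_frontier_of_tendsto' h3.tendsto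
    (E := Set.Iic 0) (by
      haveI := nullSingletonClass_gaussianReal (μ := 0) (v := 1) one_ne_zero
      simp only [frontier_Iic, ProbabilityMeasure.coe_mk]
      rw [Measure.map_apply (by fun_prop) (measurableSet_singleton _), hpre']
      simp)
  have h5 := (ENNReal.tendsto_toReal (by
    simp only [ProbabilityMeasure.coe_mk]
    exact measure_ne_top _ _)).comp h4
  have e1 : ((gaussianReal 0 1).map (fun ω : ℝ => id ω + -t₀) (Set.Iic 0)).toReal
      = stdGaussianCDF t₀ := by
    rw [Measure.map_apply (by fun_prop) measurableSet_Iic, hpre,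
      gaussianReal_apply_eq_integral _ one_ne_zero, ENNReal.toReal_ofReal
        (integral_nonneg fun x => gaussianPDFReal_nonneg _ _ _)]
    simp [stdGaussianCDF, gaussianPDFReal]
  simp only [ProbabilityMeasure.coe_mk] at h5
  rw [e1] at h5
  refine h5.congr fun n => ?_
  simp only [Function.comp_apply, ProbabilityMeasure.coe_mk, Measure.real]
  rw [Measure.map_apply (by fun_prop) measurableSet_Iic]
  congr 2
  ext ω
  simp

open Topology in
lemma floor_ratio (b' : ℝ) :
    Tendsto (fun n : ℕ => (⌊b' * √(n : ℝ)⌋ : ℝ) / √(n : ℝ)) atTop (𝓝 b') := by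
  have hs : Tendsto (fun n : ℕ => √(n : ℝ)) atTop atTop :=
    Real.tendsto_sqrt_atTop.comp tendsto_natCast_atTop_atTop
  have hi : Tendsto (fun n : ℕ => b' - 1 / √(n : ℝ)) atTop (𝓝 b') := by
    simpa using (tendsto_const_nhds (x := b')).sub (hs.inv_tendsto_atTop)
  refine tendsto_of_tendsto_of_tendsto_of_le_of_le' hi tendsto_const_nhds ?_ ?_
  · filter_upwards [hs.eventually_gt_atTop 0] with n hn
    rw [le_div_iff₀ hn, sub_mul, div_mul_cancel₀ _ hn.ne']
    exact (Int.sub_one_lt_floor _).le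
  · filter_upwards [hs.eventually_gt_atTop 0] with n hn
    rw [div_le_iff₀ hn]
    exact Int.floor_le _

open Topology in
lemma size_ratio (b' : ℝ) :
    Tendsto (fun n : ℕ => (((n : ℤ) + ⌊b' * √(n : ℝ)⌋ : ℤ) : ℝ) / n) atTop (𝓝 1) := by
  have hs : Tendsto (fun n : ℕ => √(n : ℝ)) atTop atTop :=
    Real.tendsto_sqrt_atTop.comp tendsto_natCast_atTop_atTop
  have h := ((floor_ratio b').mul hs.inv_tendsto_atTop).const_add 1
  simp only [mul_zero, add_zero] at h
  refine h.congr' ?_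
  filter_upwards [eventually_gt_atTop 0] with n hn
  have hn' : (0 : ℝ) < n := by exact_mod_cast hn
  have : √(n : ℝ) ≠ 0 := (Real.sqrt_pos.2 hn').ne'
  push_cast
  simp only [Pi.inv_apply]
  have e : √(n : ℝ) * √(n : ℝ) = n := Real.mul_self_sqrt hn'.le
  rw [add_div, div_self hn'.ne', div_mul_eq_mul_div, ← div_eq_mul_inv, div_div, e]

open ProbabilityTheory Topology in
/-- The finite sum is a probability for an i.i.d. sequence. -/
lemma sum_eq_prob {α : Type*} [Fintype α] [MeasurableSpace α] [MeasurableSingletonClass α]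
    (p : α → ℝ) (H V : ℝ) (hVpos : 0 < V) (μ : Measure α) [IsProbabilityMeasure μ]
    (hμ : ∀ a, μ.real {a} = p a)
    {Ω : Type*} {mΩ : MeasurableSpace Ω} (P : Measure Ω) [IsProbabilityMeasure P]
    (X : ℕ → Ω → α) (hX : ∀ i, Measurable (X i)) (hlaw : ∀ i, HasLaw (X i) μ P)
    (hind : iIndepFun X P) (m : ℕ) (hm : 0 < m) (c : ℝ) :
    ∑ x ∈ Finset.univ.filter
            (fun x : Fin m → α => -(Real.logb 2 (∏ i, p (x i))) ≤ c), ∏ i, p (x i) =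
    P.real {ω | (√(m : ℝ))⁻¹ * ∑ k ∈ Finset.range m, (-(Real.logb 2 (p (X k ω))) - H) / √V
      ≤ (c - m * H) / (√V * √(m : ℝ))} := by
  have hL : HasLaw (fun ω (i : Fin m) => X i ω) (Measure.pi fun _ : Fin m => μ) P :=
    (hind.precomp Fin.val_injective).hasLaw_pi (fun i => hlaw i)
  have hsing : ∀ x : Fin m → α, (Measure.pi fun _ : Fin m => μ).real {x} = ∏ i, p (x i) := by
    intro x
    simp [Measure.real, ENNReal.toReal_prod, ← hμ]
  have hfin : ∀ S : Set (Fin m → α), MeasurableSet S := fun S => (Set.toFinite S).measurableSet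
  have hsV : 0 < √V := Real.sqrt_pos.2 hVpos
  have hsm : 0 < √(m : ℝ) := Real.sqrt_pos.2 (by exact_mod_cast hm)
  have hiff : ∀ y : Fin m → α,
      (√(m : ℝ))⁻¹ * ∑ k, (-(Real.logb 2 (p (y k))) - H) / √V ≤ (c - m * H) / (√V * √(m : ℝ))
      ↔ ∑ k, -(Real.logb 2 (p (y k))) ≤ c := by
    intro y
    rw [← Finset.sum_div, Finset.sum_sub_distrib]
    simp only [Finset.sum_const, Finset.card_univ, Fintype.card_fin, nsmul_eq_mul]
    rw [inv_mul_eq_div, div_div, div_le_div_iff_of_pos_right (by positivity)]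
    exact sub_le_sub_iff_right _
  have e : {ω | (√(m : ℝ))⁻¹ * ∑ k ∈ Finset.range m, (-(Real.logb 2 (p (X k ω))) - H) / √V
      ≤ (c - m * H) / (√V * √(m : ℝ))} =
      {ω | ∑ k : Fin m, -(Real.logb 2 (p ((fun i : Fin m => X i ω) k))) ≤ c} := by
    ext ω
    rw [Set.mem_setOf_eq, Set.mem_setOf_eq, ← hiff, Finset.sum_range]
  rw [e, hL.measureReal_eq (p := fun y => ∑ k : Fin m, -(Real.logb 2 (p (y k))) ≤ c) (hfin _)]
  have e2 : {y : Fin m → α | ∑ k : Fin m, -(Real.logb 2 (p (y k))) ≤ c} =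
    ((Finset.univ.filter fun y : Fin m → α => ∑ k : Fin m, -(Real.logb 2 (p (y k))) ≤ c :
      Finset (Fin m → α)) : Set (Fin m → α)) := by
    ext; simp
  rw [e2, ← sum_measureReal_singleton]
  simp only [hsing]
  rw [Finset.sum_filter, Finset.sum_filter]
  refine Finset.sum_congr rfl fun x _ => ?_
  by_cases h : ∏ i, p (x i) = 0
  · simp [h]
  · rw [Real.logb_prod _ _ (fun i _ => (Finset.prod_ne_zero_iff.1 h) i (Finset.mem_univ i)),
      Finset.sum_neg_distrib]

/-- CLT with shifted sample size `m_n = n + ⌊b'√n⌋`: the information spectrum of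
`p^{⊗ m_n}` at threshold `H n + b √n` converges to `G((b − H b')/√V)`. -/
theorem stmt_6 {α : Type*} [Fintype α] (p : α → ℝ)
    (hp : ∀ a, 0 ≤ p a) (hsum : ∑ a, p a = 1)
    (H V : ℝ)
    (hH : H = -∑ a, p a * Real.logb 2 (p a))
    (hV : V = ∑ a, p a * (-(Real.logb 2 (p a)) - H) ^ 2)
    (hVpos : 0 < V) (b b' : ℝ) :
    Filter.Tendsto (fun n : ℕ =>
        ∑ x ∈ Finset.univ.filter
            (fun x : Fin ((n : ℤ) + ⌊b' * Real.sqrt n⌋).toNat → α =>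
            -(Real.logb 2 (∏ i, p (x i))) ≤ H * n + b * Real.sqrt n),
          ∏ i, p (x i))
      Filter.atTop (nhds (stdGaussianCDF ((b - H * b') / Real.sqrt V))) := by
  classical
  letI : MeasurableSpace α := ⊤
  haveI : MeasurableSingletonClass α := ⟨fun _ => trivial⟩
  have hmeas : ∀ f : α → ℝ, Measurable f := fun f => measurable_from_top
  let q : PMF α := PMF.ofFintype (fun a => ENNReal.ofReal (p a)) (by
    rw [← ENNReal.ofReal_sum_of_nonneg (fun a _ => hp a), hsum, ENNReal.ofReal_one])
  have hq : ∀ a, (q a).toReal = p a := fun a => by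
    simp [q, PMF.ofFintype_apply, ENNReal.toReal_ofReal (hp a)]
  have hμ : ∀ a, q.toMeasure.real {a} = p a := fun a => by
    rw [Measure.real, PMF.toMeasure_apply_singleton _ _ (measurableSet_singleton a), hq]
  obtain ⟨Ω, mΩ, P, X, hX, hlaw, hind, hP⟩ := ProbabilityTheory.exists_iid ℕ q.toMeasure
  have hsV : 0 < √V := Real.sqrt_pos.2 hVpos
  set f : α → ℝ := fun a => (-(Real.logb 2 (p a)) - H) / √V with hf
  have hint : ∀ g : α → ℝ, ∫ ω, g (X 0 ω) ∂P = ∑ a, p a * g a := fun g => by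
    have := (hlaw 0).integral_comp (f := g) (hmeas g).aestronglyMeasurable
    simp only [Function.comp_def] at this
    rw [this, PMF.integral_eq_sum]
    simp [hq]
  set m : ℕ → ℕ := fun n => ((n : ℤ) + ⌊b' * √(n : ℝ)⌋).toNat with hm
  have hN : Tendsto (fun n : ℕ => (n : ℝ)) atTop atTop := tendsto_natCast_atTop_atTop
  have hmc : ∀ᶠ n : ℕ in atTop, 0 < m n ∧ ((m n : ℝ) = (((n : ℤ) + ⌊b' * √(n : ℝ)⌋ : ℤ) : ℝ)) := by
    filter_upwards [(size_ratio b').eventually (lt_mem_nhds zero_lt_one),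
      eventually_gt_atTop 0] with n h1 h2
    have hn' : (0 : ℝ) < n := by exact_mod_cast h2
    have h3 : (0 : ℝ) < (((n : ℤ) + ⌊b' * √(n : ℝ)⌋ : ℤ) : ℝ) := by
      rcases div_pos_iff.1 h1 with h | h
      · exact h.1
      · exact absurd h.2 (not_lt.2 hn'.le)
    have h4 : 0 < (n : ℤ) + ⌊b' * √(n : ℝ)⌋ := by exact_mod_cast h3
    refine ⟨by simp only [hm]; omega, ?_⟩
    have : ((m n : ℕ) : ℤ) = (n : ℤ) + ⌊b' * √(n : ℝ)⌋ := Int.toNat_of_nonneg h4.le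
    rw [← this]; simp
  have hmr : Tendsto (fun n : ℕ => (m n : ℝ) / n) atTop (nhds 1) :=
    (size_ratio b').congr' (hmc.mono fun n h => by simp only [h.2])
  have hmt : Tendsto m atTop atTop := by
    rw [← tendsto_natCast_atTop_iff (R := ℝ)]
    refine (hmr.pos_mul_atTop zero_lt_one hN).congr' ?_
    filter_upwards [eventually_gt_atTop 0] with n hn
    have hn' : (n : ℝ) ≠ 0 := by exact_mod_cast hn.ne'
    field_simp
  have ht : Tendsto (fun n : ℕ => (H * n + b * √(n : ℝ) - m n * H) / (√V * √(m n : ℝ))) atTop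
      (nhds ((b - H * b') / √V)) := by
    have h1 := (((floor_ratio b').const_mul H).const_sub b).div
      (((Real.continuous_sqrt.tendsto 1).comp hmr).const_mul √V) (by simp [hsV.ne'])
    simp only [Real.sqrt_one, mul_one] at h1
    refine h1.congr' ?_
    filter_upwards [hmc, eventually_gt_atTop 0] with n h hn
    have hn' : (0 : ℝ) < n := by exact_mod_cast hn
    have hs : 0 < √(n : ℝ) := Real.sqrt_pos.2 hn'
    have hms : 0 < √(m n : ℝ) := Real.sqrt_pos.2 (by exact_mod_cast h.1)
    have e : H * n + b * √(n : ℝ) - m n * H = b * √(n : ℝ) - H * ⌊b' * √(n : ℝ)⌋ := by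
      rw [h.2]; push_cast; ring
    simp only [Pi.div_apply, Function.comp_apply]
    rw [e, Real.sqrt_div (Nat.cast_nonneg _)]
    field_simp
  have hfX : ∀ i, Measurable (fun ω => f (X i ω)) := fun i => (hmeas f).comp (hX i)
  have key := clt_shift P (fun i ω => f (X i ω)) hfX ?_ ?_
    (hind.comp (fun _ => f) (fun _ => hmeas f)) ?_ m hmt _ _ ht
  · refine key.congr' (hmc.mono fun n h => ?_)
    exact (sum_eq_prob p H V hVpos q.toMeasure hμ P X hX hlaw hind (m n) h.1 _).symm
  · rw [hint]
    simp only [hf, ← mul_div_assoc]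
    rw [← Finset.sum_div]
    simp only [mul_sub, Finset.sum_sub_distrib, ← Finset.sum_mul, hsum, mul_neg,
      Finset.sum_neg_distrib]
    rw [← hH]; simp
  · have := hint (fun a => f a ^ 2)
    simp only [Pi.pow_apply]
    rw [this]
    simp only [hf, div_pow, Real.sq_sqrt hVpos.le, ← mul_div_assoc]
    rw [← Finset.sum_div, ← hV, div_self hVpos.ne']
  · intro i
    exact ProbabilityTheory.IdentDistrib.comp
      ⟨(hX i).aemeasurable, (hX 0).aemeasurable, by rw [(hlaw i).map_eq, (hlaw 0).map_eq]⟩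
      (hmeas f)
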